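/- arXiv:2604.27442 — 2 statements merged into one kernel-verified Lean document; each statement's English description precedes it below -/
import Mathlib

section
/- Rates of convergence for the Bayesian online one-pass recursion: there exist constants M > 0 depending only on K₁,…,K₅, L₁, L₂, C₀, r and K > 0 depending only on K₂, K₃, K₄, K₅, C₀ such that the following holds. If t₀ ≥ ⌈M(p·log(max(p,3)) + x)⌉ and assumptions (A1), (A2), (A4), (A5) hold, then for every t ∈ ℕ with t ≥ t₀: V_t ≤ K(p log t + x), ‖θ_t − θ⋆‖₂ ≤ K√((p log t + x)/t), and θ_t ∈ Θ_r; in particular t_exit = ∞. -/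
open Matrix MeasureTheory Real
open scoped RealInnerProductSpace BigOperators ENNReal

noncomputable section

/-- Vectors in `ℝ^p` with the Euclidean (`ℓ²`) norm. -/
abbrev Vec (p : ℕ) := EuclideanSpace ℝ (Fin p)

/-- Real `p × p` matrices. -/
abbrev Mat (p : ℕ) := Matrix (Fin p) (Fin p) ℝ

/-- A matrix applied to a Euclidean vector. -/
def mApp {p : ℕ} (A : Mat p) (v : Vec p) : Vec p := Matrix.toEuclideanLin A v

/-- The quadratic form `vᵀ A v`. For positive semidefinite `A` this equals
`‖A^{1/2} v‖₂²`. -/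
def quadForm {p : ℕ} (A : Mat p) (v : Vec p) : ℝ := ⟪v, mApp A v⟫

/-- The `ℓ² → ℓ²` operator (spectral) norm of a matrix. -/
def specNorm {p : ℕ} (A : Mat p) : ℝ :=
  ‖LinearMap.toContinuousLinearMap (Matrix.toEuclideanLin A)‖

/-- The exit time `t_exit = inf {t ∈ ℕ : t > t₀, θ_t ∉ Θ_r}`, valued in `ℕ∞`
(with `inf ∅ = ∞`). -/
def texit {p : ℕ} (θstar : Vec p) (r : ℝ) (t₀ : ℕ) (θ : ℕ → Vec p) : ℕ∞ :=
  sInf {n : ℕ∞ | ∃ t : ℕ, n = (t : ℕ∞) ∧ t₀ < t ∧ r < ‖θ t - θstar‖}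


theorem mApp_add_mat {p : ℕ} (A B : Mat p) (v : Vec p) : mApp (A + B) v = mApp A v + mApp B v := by
  simp [mApp]

theorem mApp_sub_vec {p : ℕ} (A : Mat p) (v w : Vec p) : mApp A (v - w) = mApp A v - mApp A w := by
  simp [mApp]

theorem quadForm_add_mat {p : ℕ} (A B : Mat p) (v : Vec p) :
    quadForm (A + B) v = quadForm A v + quadForm B v := by
  simp [quadForm, mApp_add_mat, inner_add_right]

theorem quadForm_smul_vec {p : ℕ} (A : Mat p) (c : ℝ) (v : Vec p) :
    quadForm A (c • v) = c ^ 2 * quadForm A v := by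
  simp [quadForm, mApp, inner_smul_left, inner_smul_right]; ring

theorem quadForm_eq_dot {p : ℕ} (A : Mat p) (v : Vec p) :
    quadForm A v = star (v.ofLp) ⬝ᵥ (A *ᵥ v.ofLp) := by
  simp [quadForm, mApp, Matrix.toLpLin_apply, EuclideanSpace.inner_eq_star_dotProduct, dotProduct_comm]

theorem quadForm_nonneg {p : ℕ} {A : Mat p} (hA : A.PosSemidef) (v : Vec p) : 0 ≤ quadForm A v := by
  rw [quadForm_eq_dot]; exact hA.dotProduct_mulVec_nonneg _

theorem mApp_symm {p : ℕ} {A : Mat p} (hA : A.IsHermitian) (v w : Vec p) :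
    ⟪mApp A v, w⟫ = ⟪v, mApp A w⟫ := by
  have := (Matrix.isSymmetric_toEuclideanLin_iff.2 hA) v w
  simpa [mApp] using this

theorem isHermitian_of_symm {p : ℕ} {A : Mat p} (h : ∀ v w : Vec p, ⟪mApp A v, w⟫ = ⟪v, mApp A w⟫) :
    A.IsHermitian := by
  rw [← Matrix.isSymmetric_toEuclideanLin_iff]
  intro v w
  simpa [mApp] using h v w

theorem mApp_inv {p : ℕ} {A : Mat p} (hA : A.PosDef) (v : Vec p) : mApp A (mApp A⁻¹ v) = v := by
  have hu : IsUnit A.det := (Matrix.isUnit_iff_isUnit_det A).1 hA.isUnit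
  simp [mApp, Matrix.toLpLin_apply, Matrix.mul_nonsing_inv _ hu]

theorem posDef_of_quadForm {p : ℕ} {A : Mat p} (hA : A.IsHermitian)
    (h : ∀ v : Vec p, v ≠ 0 → 0 < quadForm A v) : A.PosDef := by
  refine Matrix.PosDef.of_dotProduct_mulVec_pos hA ?_
  intro x hx
  have := h (WithLp.toLp 2 x) (by simpa using hx)
  rwa [quadForm_eq_dot] at this

theorem quadForm_le_spec {p : ℕ} (A : Mat p) (v : Vec p) :
    quadForm A v ≤ specNorm A * ‖v‖ ^ 2 := by
  have h1 : quadForm A v ≤ ‖v‖ * ‖mApp A v‖ := real_inner_le_norm _ _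
  have h2 : ‖mApp A v‖ ≤ specNorm A * ‖v‖ :=
    (LinearMap.toContinuousLinearMap (Matrix.toEuclideanLin A)).le_opNorm v
  nlinarith [norm_nonneg v]

theorem hess_symm {p : ℕ} {f : Vec p → ℝ} {g : Vec p → Vec p} {H : Vec p → Mat p}
    (hg : ∀ y, HasGradientAt f (g y) y)
    (hH : ∀ y, HasFDerivAt g
        (LinearMap.toContinuousLinearMap (Matrix.toEuclideanLin (H y))) y) (y : Vec p) :
    (H y).IsHermitian := by
  apply isHermitian_of_symm
  intro v w
  have h1 : ∀ y, HasFDerivAt f (innerSL ℝ (g y)) y := fun y => (hg y).hasFDerivAt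
  have h2 : HasFDerivAt (fun y => innerSL ℝ (g y))
      ((innerSL ℝ).comp (LinearMap.toContinuousLinearMap (Matrix.toEuclideanLin (H y)))) y :=
    (innerSL ℝ (E := Vec p)).hasFDerivAt.comp y (hH y)
  have := second_derivative_symmetric h1 h2 v w
  simp at this
  rw [real_inner_comm (mApp (H y) w) v]
  exact this

theorem quad_update {p : ℕ} {A B : Mat p} (hA : A.PosDef) (u g : Vec p) (O H : Mat p)
    (hB : B = A⁻¹) (hO : A = O + H) :
    quadForm A (u - mApp B g) = quadForm O u + quadForm H u - 2 * ⟪g, u⟫ + quadForm B g := by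
  subst hB
  have e1 : quadForm O u + quadForm H u = quadForm A u := by rw [hO, quadForm_add_mat]
  rw [e1]
  have hs := mApp_symm hA.isHermitian u (mApp A⁻¹ g)
  rw [mApp_inv hA] at hs
  simp only [quadForm, mApp_sub_vec, mApp_inv hA, inner_sub_left, inner_sub_right]
  rw [real_inner_comm (mApp A u) (mApp A⁻¹ g), real_inner_comm u g, hs, real_inner_comm g (mApp A⁻¹ g)]
  ring

theorem slope_lemma {h h' : ℝ → ℝ} {κ : ℝ} (hd : ∀ b, HasDerivAt h (h' b) b)
    (hR : ∀ b, 0 ≤ b → b < 1 → κ / 2 * (1 - b) ^ 2 ≤ h 1 - h b - h' b * (1 - b)) :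
    κ / 2 ≤ h 0 - h 1 + h' 1 := by
  have key : MonotoneOn (fun b => dslope h 1 b - κ / 2 * b) (Set.Icc 0 1) := by
    have hder : ∀ b ∈ Set.Ioo (0:ℝ) 1, HasDerivAt (fun b => dslope h 1 b - κ / 2 * b)
        ((h' b * (b - 1) - (h b - h 1)) / (b - 1) ^ 2 - κ / 2) b := by
      intro b hb
      have hne : b - 1 ≠ 0 := by linarith [hb.2] |> fun h : b - 1 < 0 => h.ne
      have e : dslope h 1 =ᶠ[nhds b] fun b => (h b - h 1) / (b - 1) := by
        filter_upwards [isOpen_ne.mem_nhds (show b ≠ 1 from hb.2.ne)] with c hc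
        rw [dslope_of_ne _ hc, slope_def_field]
      have h1 : HasDerivAt (fun b => (h b - h 1) / (b - 1))
        ((h' b * (b - 1) - (h b - h 1) * 1) / (b - 1) ^ 2) b :=
        ((hd b).sub_const _).fun_div ((hasDerivAt_id b).sub_const 1) hne
      have h2 := (h1.congr_of_eventuallyEq e).fun_sub ((hasDerivAt_id b).const_mul (κ / 2))
      simp only [mul_one, id] at h2
      exact h2
    refine monotoneOn_of_deriv_nonneg (convex_Icc 0 1) ?_ ?_ ?_
    · intro b hb
      refine ContinuousAt.continuousWithinAt ?_
      refine ContinuousAt.sub ?_ (by fun_prop)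
      by_cases hb1 : b = 1
      · subst hb1
        exact continuousAt_dslope_same.2 (hd 1).differentiableAt
      · exact (continuousAt_dslope_of_ne hb1).2 (hd b).continuousAt
    · rw [interior_Icc]
      intro b hb
      exact (hder b hb).differentiableAt.differentiableWithinAt
    · rw [interior_Icc]
      intro b hb
      rw [(hder b hb).deriv, sub_nonneg, le_div_iff₀ (by nlinarith [hb.2])]
      have := hR b hb.1.le hb.2
      nlinarith
  have := key (Set.left_mem_Icc.2 zero_le_one) (Set.right_mem_Icc.2 zero_le_one) zero_le_one
  simp only [dslope_same, (hd 1).deriv, dslope_of_ne _ (zero_ne_one (α := ℝ)), slope_def_field] at this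
  norm_num at this
  linarith

theorem taylor_lemma {p : ℕ} {f : Vec p → ℝ} {g : Vec p → Vec p} {H : Vec p → Mat p}
    {θs y : Vec p} {r L₁ L₂ : ℝ} (hL1 : 0 ≤ L₁)
    (hg : ∀ y, HasGradientAt f (g y) y)
    (hA2 : ∀ (θ₁ θ₂ : Vec p), ‖θ₁ - θs‖ ≤ r → ‖θ₂ - θs‖ ≤ r →
        ∃ φ : ℝ, 0 ≤ φ ∧ φ ≤ L₁ * ‖θ₁ - θ₂‖ ∧ ∃ c ∈ Set.Icc (0 : ℝ) 1,
          f θ₁ = f θ₂ + ⟪g θ₂, θ₁ - θ₂⟫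
              + (1 / 2) * quadForm (H (θ₂ + c • (θ₁ - θ₂))) (θ₁ - θ₂) ∧
          ((1 + φ) • H (θ₂ + c • (θ₁ - θ₂)) - H θ₁).PosSemidef)
    (hL : specNorm (H y) ≤ L₂) (hy : ‖y - θs‖ ≤ r) (hP : (H y).PosSemidef) :
    quadForm (H y) (y - θs) - 2 * ⟪g y, y - θs⟫ ≤
      2 * (f θs - f y) + L₁ * L₂ * ‖y - θs‖ ^ 3 := by
  set Δ := y - θs with hΔ
  have hyΔ : y = θs + (1:ℝ) • Δ := by simp [hΔ]
  set Q := quadForm (H y) Δ with hQ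
  have hQ0 : 0 ≤ Q := quadForm_nonneg hP _
  have hQ1 : Q ≤ L₂ * ‖Δ‖ ^ 2 := (quadForm_le_spec _ _).trans (by gcongr)
  have hden : 0 < 1 + L₁ * ‖Δ‖ := by positivity
  have hs := slope_lemma (h := fun b => f (θs + b • Δ)) (h' := fun b => ⟪g (θs + b • Δ), Δ⟫)
    (κ := Q / (1 + L₁ * ‖Δ‖)) (by
      intro b
      have h1 : HasDerivAt (fun b : ℝ => θs + b • Δ) Δ b := by
        simpa using ((hasDerivAt_id b).smul_const Δ).const_add θs
      have h2 := (hg (θs + b • Δ)).hasFDerivAt.comp_hasDerivAt b h1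
      simp at h2
      exact h2) (by
      intro b hb0 hb1
      have hdiff : y - (θs + b • Δ) = (1 - b) • Δ := by
        rw [sub_smul, one_smul, hΔ]; abel
      have hr2 : ‖θs + b • Δ - θs‖ ≤ r := by
        rw [add_sub_cancel_left, norm_smul, Real.norm_of_nonneg hb0]
        nlinarith [norm_nonneg Δ]
      obtain ⟨φ, hφ0, hφ, c, -, heq, hps⟩ := hA2 y (θs + b • Δ) hy hr2
      rw [hdiff] at hφ heq hps
      set Ht := H (θs + b • Δ + c • (1 - b) • Δ)
      have hq : Q ≤ (1 + φ) * quadForm Ht Δ := by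
        have := quadForm_nonneg hps Δ
        simp [quadForm, mApp, inner_sub_right, inner_smul_right] at this
        simpa [hQ, quadForm, mApp] using this
      rw [norm_smul, Real.norm_of_nonneg (by linarith)] at hφ
      have hφ' : φ ≤ L₁ * ‖Δ‖ := hφ.trans (by
        have : (1 - b) * ‖Δ‖ ≤ ‖Δ‖ := by nlinarith [norm_nonneg Δ]
        gcongr)
      have hqt : 0 ≤ quadForm Ht Δ := by
        by_contra hneg
        push Not at hneg
        nlinarith
      have hk : Q / (1 + L₁ * ‖Δ‖) ≤ quadForm Ht Δ := by
        rw [div_le_iff₀ hden]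
        nlinarith
      rw [quadForm_smul_vec, inner_smul_right] at heq
      have e1 : f (θs + (1:ℝ) • Δ) = f y := by rw [← hyΔ]
      simp only [e1]
      rw [heq]
      nlinarith [sq_nonneg (1 - b)])
  simp only [← hyΔ] at hs
  simp only [zero_smul, add_zero] at hs
  have hfin : Q - Q / (1 + L₁ * ‖Δ‖) ≤ L₁ * L₂ * ‖Δ‖ ^ 3 := by
    have h1 : Q - Q / (1 + L₁ * ‖Δ‖) ≤ Q * (L₁ * ‖Δ‖) := by
      rw [sub_le_iff_le_add, ← sub_le_iff_le_add', le_div_iff₀ hden]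
      nlinarith [mul_nonneg hQ0 (sq_nonneg (L₁ * ‖Δ‖))]
    have h2 : Q * (L₁ * ‖Δ‖) ≤ (L₂ * ‖Δ‖ ^ 2) * (L₁ * ‖Δ‖) := by gcongr
    nlinarith
  linarith

set_option maxHeartbeats 1000000 in
theorem rate_lemma {p t₀ s : ℕ} {x M η : ℝ} (hp : 1 ≤ p) (hx : 0 < x) (hM : 3 ≤ M) (hη0 : 0 < η)
    (hη : 10 ≤ η * √M) (ht : M * (p * Real.log (max (p : ℝ) 3) + x) ≤ t₀) (hs : t₀ ≤ s) :
    1 ≤ Real.log t₀ ∧ (p * Real.log s + x) ≤ η * (√(s:ℝ) * √(t₀:ℝ)) := by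
  set T : ℝ := (t₀ : ℝ) with hT
  set S : ℝ := (s : ℝ) with hS
  set P : ℝ := (p : ℝ) with hP
  have hp1 : (1:ℝ) ≤ P := by simpa [hP] using hp
  have hTS : T ≤ S := by simpa [hT, hS] using hs
  have he3 : Real.exp 1 ≤ 3 := by linarith [Real.exp_one_lt_d9]
  have hm3 : (3:ℝ) ≤ max P 3 := le_max_right _ _
  set Lg := Real.log (max P 3) with hLg
  have hLg1 : 1 ≤ Lg := by
    rw [hLg, Real.le_log_iff_exp_le (by linarith)]; linarith
  have hlogP : Real.log P ≤ Lg := Real.log_le_log (by linarith) (le_max_left _ _)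
  set N := P * Lg with hN
  have hNP : P ≤ N := by nlinarith
  have hN1 : 1 ≤ N := by linarith
  have hM0 : 0 < M := by linarith
  have hsM : 1 ≤ √M := by rw [Real.one_le_sqrt]; linarith
  have hsM2 : √M * √M = M := Real.mul_self_sqrt hM0.le
  have hsMM : √M ≤ M := by nlinarith
  have hTN : M * N ≤ T := by nlinarith
  have hTx : M * x ≤ T := by nlinarith
  have hT3 : 3 ≤ T := by nlinarith
  have hlogT : 1 ≤ Real.log T := by
    rw [Real.le_log_iff_exp_le (by linarith)]; linarith
  refine ⟨hlogT, ?_⟩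
  have hlogN : Real.log N ≤ 2 * Lg := by
    rw [hN, Real.log_mul (by linarith) (by linarith)]
    linarith [Real.log_le_self (show 0 ≤ Lg by linarith)]
  -- bound at t₀
  have hA : (P * Real.log T + x) * √M ≤ 5 * T := by
    set y := √(T / N) with hy
    have hTN0 : 0 < T / N := by positivity
    have hy2 : y * y = T / N := Real.mul_self_sqrt hTN0.le
    have hyM : √M ≤ y := Real.sqrt_le_sqrt (by rw [le_div_iff₀ (by linarith)]; exact hTN)
    have hy0 : 0 < y := by linarith
    have hlog : Real.log T = Real.log N + 2 * Real.log y := by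
      have : T = N * (y * y) := by rw [hy2]; field_simp
      rw [this, Real.log_mul (by linarith) (by positivity), Real.log_mul hy0.ne' hy0.ne']; ring
    have hly : Real.log y ≤ y := Real.log_le_self hy0.le
    have h1 : N * (y * √M) ≤ T := by
      have : T = N * (y * y) := by rw [hy2]; field_simp
      rw [this]; gcongr
    have h2 : P * Real.log y * √M ≤ T := by
      calc P * Real.log y * √M ≤ P * y * √M := by gcongr
        _ ≤ N * y * √M := by gcongr
        _ ≤ T := by linarith
    have h3 : P * Real.log N * √M ≤ 2 * T := by
      calc P * Real.log N * √M ≤ P * (2 * Lg) * √M := by gcongr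
        _ = 2 * (N * √M) := by rw [hN]; ring
        _ ≤ 2 * (M * N) := by rw [mul_comm M N]; gcongr
        _ ≤ 2 * T := by linarith
    have h4 : x * √M ≤ T := by
      have : x * √M ≤ x * M := by gcongr
      linarith
    rw [hlog]; linarith
  set z := √(S / T) with hz
  have hz2 : z * z = S / T := Real.mul_self_sqrt (by positivity)
  have hz1 : 1 ≤ z := by rw [hz, Real.one_le_sqrt, le_div_iff₀ (by linarith)]; linarith
  have hSz : S = T * (z * z) := by rw [hz2]; field_simp
  have hlogS : Real.log S ≤ 2 * z * Real.log T := by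
    rw [hSz, Real.log_mul (by linarith) (by positivity), Real.log_mul (by positivity) (by positivity)]
    have := Real.log_le_sub_one_of_pos (show 0 < z by linarith)
    nlinarith
  have hzT : √S * √T = z * T := by
    rw [← Real.sqrt_mul (by linarith), hSz, show T * (z * z) * T = (z * T) * (z * T) by ring,
      Real.sqrt_mul_self (by positivity)]
  rw [hzT]
  have h5 : P * Real.log S + x ≤ 2 * z * (P * Real.log T + x) := by
    have : P * Real.log S ≤ P * (2 * z * Real.log T) := by gcongr
    have h8 : 1 * x ≤ (2 * z) * x := by gcongr; linarith
    linarith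
  have h6 : P * Real.log T + x ≤ η * T / 2 := by
    have h0 : 0 ≤ P * Real.log T + x := by positivity
    have : (P * Real.log T + x) * √M ≤ (η * T / 2) * √M := by
      have h9 : 10 * T ≤ (η * √M) * T := by gcongr
      linarith
    exact le_of_mul_le_mul_right this (by linarith)
  calc _ ≤ 2 * z * (P * Real.log T + x) := h5
    _ ≤ 2 * z * (η * T / 2) := by gcongr
    _ = _ := by ring

theorem w_step (m : ℕ) (hm : 1 ≤ m) :
    1 / ((m:ℝ) * √√(m:ℝ)) ≤ 8 / √√(m:ℝ) - 8 / √√((m + 1 : ℕ):ℝ) := by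
  set u := √√(m:ℝ) with hu
  set v := √√((m + 1 : ℕ):ℝ) with hv
  have hm0 : (1:ℝ) ≤ m := by exact_mod_cast hm
  have hu0 : 0 < u := by positivity
  have hv0 : 0 < v := by positivity
  have huv : u ≤ v := Real.sqrt_le_sqrt (Real.sqrt_le_sqrt (by push_cast; linarith))
  have hu4 : u ^ 4 = m := by
    rw [show u ^ 4 = (u ^ 2) ^ 2 by ring, hu, Real.sq_sqrt (by positivity), Real.sq_sqrt (by positivity)]
  have hv4 : v ^ 4 = m + 1 := by
    rw [show v ^ 4 = (v ^ 2) ^ 2 by ring, hv, Real.sq_sqrt (by positivity), Real.sq_sqrt (by positivity)]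
    push_cast; ring
  have h1 : 1 ≤ (v - u) * (4 * v ^ 3) := by
    have e : (v - u) * (v ^ 3 + v ^ 2 * u + v * u ^ 2 + u ^ 3) = 1 := by
      have : (v - u) * (v ^ 3 + v ^ 2 * u + v * u ^ 2 + u ^ 3) = v ^ 4 - u ^ 4 := by ring
      rw [this, hu4, hv4]; ring
    rw [← e]
    have a1 : v ^ 2 * u ≤ v ^ 2 * v := by gcongr
    have a2 : v * u ^ 2 ≤ v * v ^ 2 := by gcongr
    have a3 : u ^ 3 ≤ v ^ 3 := by gcongr
    apply mul_le_mul_of_nonneg_left _ (by linarith)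
    nlinarith
  rw [← hu4]
  have hv2 : v ^ 4 ≤ 2 * u ^ 4 := by rw [hu4, hv4]; linarith
  rw [div_sub_div _ _ hu0.ne' hv0.ne', div_le_div_iff₀ (by positivity) (by positivity)]
  have h2 : v ≤ (v - u) * (4 * v ^ 4) := by nlinarith
  have h3 : (v - u) * (4 * v ^ 4) ≤ (v - u) * (4 * (2 * u ^ 4)) := by
    apply mul_le_mul_of_nonneg_left _ (by linarith); linarith
  nlinarith

theorem w_sum (t₀ n : ℕ) (h0 : 1 ≤ t₀) :
    ∑ s ∈ Finset.Icc (t₀ + 1) (t₀ + n), 1 / (((s - 1 : ℕ):ℝ) * √√((s - 1 : ℕ):ℝ))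
      ≤ 8 / √√(t₀:ℝ) - 8 / √√((t₀ + n : ℕ):ℝ) := by
  induction n with
  | zero => simp
  | succ k ih =>
    rw [← add_assoc, Finset.sum_Icc_succ_top (by omega)]
    have := w_step (t₀ + k) (by omega)
    simp only [Nat.add_sub_cancel] at *
    linarith

theorem Omega_sum {p t₀ : ℕ} {hess : ℕ → Vec p → Mat p} {Ω₀ : Mat p} {θ : ℕ → Vec p}
    {Ω : ℕ → Mat p}
    (h0 : Ω t₀ = Ω₀ + ∑ s ∈ Finset.Icc 1 t₀, hess s (θ t₀))
    (hΩ : ∀ t, t₀ < t → Ω t = Ω (t - 1) + hess t (θ (t - 1))) (n : ℕ) :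
    Ω (t₀ + n) = Ω₀ + ∑ s ∈ Finset.Icc 1 (t₀ + n), hess s (if s ≤ t₀ then θ t₀ else θ (s - 1)) := by
  induction n with
  | zero =>
    rw [add_zero, h0]
    congr 1
    apply Finset.sum_congr rfl
    intro s hs
    rw [if_pos (Finset.mem_Icc.1 hs).2]
  | succ k ih =>
    rw [← add_assoc, Finset.sum_Icc_succ_top (by omega), hΩ _ (by omega), ← add_assoc,
      if_neg (by omega), Nat.add_sub_cancel, ih]

theorem hsum_step {p t₀ : ℕ} {r L₁ L₂ : ℝ} {ℓ : ℕ → Vec p → ℝ} {grad : ℕ → Vec p → Vec p}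
    {hess : ℕ → Vec p → Mat p} {θ : ℕ → Vec p} {θstar : Vec p}
    {Ω : ℕ → Mat p} (hL1 : 0 ≤ L₁)
    (hgr : ∀ t y, HasGradientAt (ℓ t) (grad t y) y)
    (hΩ : ∀ t, t₀ < t → Ω t = Ω (t - 1) + hess t (θ (t - 1)))
    (hθ : ∀ t, t₀ < t → θ t = θ (t - 1) - mApp (Ω t)⁻¹ (grad t (θ (t - 1))))
    (hP : ∀ t, t₀ < t → (hess t (θ (t - 1))).PosSemidef)
    (hA2 : ∀ (t : ℕ) (θ₁ θ₂ : Vec p), ‖θ₁ - θstar‖ ≤ r → ‖θ₂ - θstar‖ ≤ r →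
        ∃ φ : ℝ, 0 ≤ φ ∧ φ ≤ L₁ * ‖θ₁ - θ₂‖ ∧ ∃ c ∈ Set.Icc (0 : ℝ) 1,
          ℓ t θ₁ = ℓ t θ₂ + ⟪grad t θ₂, θ₁ - θ₂⟫
              + (1 / 2) * quadForm (hess t (θ₂ + c • (θ₁ - θ₂))) (θ₁ - θ₂) ∧
          ((1 + φ) • hess t (θ₂ + c • (θ₁ - θ₂)) - hess t θ₁).PosSemidef)
    (hL2 : ∀ (t : ℕ) (y : Vec p), ‖y - θstar‖ ≤ r → specNorm (hess t y) ≤ L₂)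
    (n : ℕ)
    (hPD : ∀ k ≤ n, (Ω (t₀ + k)).PosDef)
    (hin : ∀ k < n, ‖θ (t₀ + k) - θstar‖ ≤ r) :
    quadForm (Ω (t₀ + n)) (θ (t₀ + n) - θstar) ≤ quadForm (Ω t₀) (θ t₀ - θstar)
      + L₁ * L₂ * ∑ s ∈ Finset.Icc (t₀ + 1) (t₀ + n), ‖θ (s - 1) - θstar‖ ^ 3
      + 2 * ∑ s ∈ Finset.Icc (t₀ + 1) (t₀ + n), (ℓ s θstar - ℓ s (θ (s - 1)))
      + ∑ s ∈ Finset.Icc (t₀ + 1) (t₀ + n), quadForm (Ω s)⁻¹ (grad s (θ (s - 1))) := by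
  induction n with
  | zero => simp
  | succ k ih =>
    have ih' := ih (fun j hj => hPD j (by omega)) (fun j hj => hin j (by omega))
    have hk := hin k (by omega)
    have e1 : t₀ + k + 1 - 1 = t₀ + k := by omega
    have hpd := hPD (k + 1) le_rfl
    rw [← add_assoc] at hpd ⊢
    have hps := hP (t₀ + k + 1) (by omega)
    have hO := hΩ (t₀ + k + 1) (by omega)
    have ht := hθ (t₀ + k + 1) (by omega)
    rw [Finset.sum_Icc_succ_top (by omega), Finset.sum_Icc_succ_top (by omega),
      Finset.sum_Icc_succ_top (by omega)]
    rw [e1] at hps hO ht ⊢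
    have hT := taylor_lemma hL1 (hgr (t₀ + k + 1)) (hA2 (t₀ + k + 1)) (hL2 _ _ hk) hk hps
    have hQ := quad_update hpd (θ (t₀ + k) - θstar) (grad (t₀ + k + 1) (θ (t₀ + k))) _ _ rfl hO
    have e2 : θ (t₀ + k + 1) - θstar = (θ (t₀ + k) - θstar) -
        mApp (Ω (t₀ + k + 1))⁻¹ (grad (t₀ + k + 1) (θ (t₀ + k))) := by
      rw [ht]; abel
    rw [e2, hQ]
    linarith

theorem le_of_sq_le_sq_aux {a b : ℝ} (h : a ^ 2 ≤ b ^ 2) (hb : 0 ≤ b) : a ≤ b :=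
  abs_le_of_sq_le_sq' h hb |>.2

set_option maxHeartbeats 4000000 in
/-- rates of convergence for the Bayesian online one-pass
recursion (Theorem 1 of the paper).  The quantifier order encodes the
dependencies: `K = K(K₂, K₃, K₄, K₅, C₀)` and `M = M(K₁,…,K₅, L₁, L₂, C₀, r)`. -/
theorem stmt4 :
    ∀ K₂ K₃ K₄ K₅ C₀ : ℝ, 0 < K₂ → 0 < K₃ → 0 < K₄ → 0 < K₅ → 0 < C₀ →
    ∃ K : ℝ, 0 < K ∧
    ∀ K₁ L₁ L₂ r : ℝ, 0 < K₁ → 0 ≤ L₁ → 0 < L₂ → 0 < r →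
    ∃ M : ℝ, 0 < M ∧
    ∀ (p : ℕ) (x : ℝ) (θstar : Vec p) (ℓ : ℕ → Vec p → ℝ)
      (grad : ℕ → Vec p → Vec p) (hess : ℕ → Vec p → Mat p)
      (t₀ : ℕ) (Ω₀ : Mat p) (θ : ℕ → Vec p) (Ω : ℕ → Mat p),
      0 < x →
      -- ℓ_t is C² with gradient `grad` and Hessian `hess`
      (∀ t y, HasGradientAt (ℓ t) (grad t y) y) →
      (∀ t y, HasFDerivAt (grad t)
        (LinearMap.toContinuousLinearMap (Matrix.toEuclideanLin (hess t y))) y) →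
      (∀ t, Continuous (hess t)) →
      -- algorithm
      Ω₀.PosDef →
      Ω t₀ = Ω₀ + ∑ s ∈ Finset.Icc 1 t₀, hess s (θ t₀) →
      (∀ t, t₀ < t → Ω t = Ω (t - 1) + hess t (θ (t - 1))) →
      (∀ t, t₀ < t → θ t = θ (t - 1) - mApp (Ω t)⁻¹ (grad t (θ (t - 1)))) →
      (∀ t, t₀ < t → (hess t (θ (t - 1))).PosSemidef) →
      -- (A1)
      (∀ t : ℕ, K₁ * (p + x) ≤ (t : ℝ) → ∀ θbar : ℕ → Vec p,
        (∀ s ∈ Finset.Icc 1 t, ‖θbar s - θstar‖ ≤ r) →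
        ∀ v : Vec p, K₂ * t * ‖v‖ ^ 2 ≤
          quadForm (∑ s ∈ Finset.Icc 1 t, hess s (θbar s)) v) →
      -- (A2)
      (∀ (t : ℕ) (θ₁ θ₂ : Vec p), ‖θ₁ - θstar‖ ≤ r → ‖θ₂ - θstar‖ ≤ r →
        ∃ φ : ℝ, 0 ≤ φ ∧ φ ≤ L₁ * ‖θ₁ - θ₂‖ ∧ ∃ c ∈ Set.Icc (0 : ℝ) 1,
          ℓ t θ₁ = ℓ t θ₂ + ⟪grad t θ₂, θ₁ - θ₂⟫
              + (1 / 2) * quadForm (hess t (θ₂ + c • (θ₁ - θ₂))) (θ₁ - θ₂) ∧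
          ((1 + φ) • hess t (θ₂ + c • (θ₁ - θ₂)) - hess t θ₁).PosSemidef) →
      (∀ (t : ℕ) (y : Vec p), ‖y - θstar‖ ≤ r → specNorm (hess t y) ≤ L₂) →
      -- (A4)
      K₁ * (p + x) ≤ (t₀ : ℝ) →
      (∀ t : ℕ, t₀ < t →
        ∑ s ∈ Finset.Icc (t₀ + 1) t, (ℓ s θstar - ℓ s (θ (s - 1))) ≤ K₃ * x) →
      (∀ t : ℕ, t₀ < t → (t : ℕ∞) ≤ texit θstar r t₀ θ →
        ∑ s ∈ Finset.Icc (t₀ + 1) t, quadForm (Ω s)⁻¹ (grad s (θ (s - 1)))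
          ≤ K₄ * p * Real.log t + K₅ * (x + Real.log t)) →
      -- (A5)
      ‖θ t₀ - θstar‖ ≤ r →
      quadForm (Ω t₀) (θ t₀ - θstar) ≤ C₀ * (p + x) →
      -- warm-start length
      ⌈M * (p * Real.log (max (p : ℝ) 3) + x)⌉₊ ≤ t₀ →
      -- conclusion
      (∀ t : ℕ, t₀ ≤ t →
        quadForm (Ω t) (θ t - θstar) ≤ K * (p * Real.log t + x) ∧
        ‖θ t - θstar‖ ≤ K * Real.sqrt ((p * Real.log t + x) / t) ∧
        ‖θ t - θstar‖ ≤ r) ∧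
      texit θstar r t₀ θ = ⊤ := by
  intro K₂ K₃ K₄ K₅ C₀ hK2 hK3 hK4 hK5 hC0
  set B := C₀ + 2 * K₃ + K₄ + K₅ with hB
  have hB0 : 0 < B := by positivity
  set D := 2 * B / K₂ with hD
  have hD0 : 0 < D := by positivity
  refine ⟨1 + 2 * B + D, by positivity, ?_⟩
  intro K₁ L₁ L₂ r hK1 hL1 hL2 hr
  set τ := min r (B / (8 * D * (L₁ * L₂ + 1))) with hτ
  have hLL : 0 ≤ L₁ * L₂ := by positivity
  have hτ0 : 0 < τ := lt_min hr (by positivity)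
  have hτr : τ ≤ r := min_le_left _ _
  have hτB : L₁ * L₂ * (8 * D * τ) ≤ B := by
    have : τ ≤ B / (8 * D * (L₁ * L₂ + 1)) := min_le_right _ _
    rw [le_div_iff₀ (by positivity)] at this
    nlinarith [mul_pos hD0 hτ0]
  set η := τ ^ 2 / D with hη
  have hη0 : 0 < η := by positivity
  have hDη : D * η = τ ^ 2 := by rw [hη]; field_simp
  set M := 3 + (10 / η) ^ 2 with hM
  have hM3 : 3 ≤ M := by rw [hM]; nlinarith [sq_nonneg (10 / η)]
  have hMη : 10 ≤ η * √M := by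
    have h1 : 10 / η ≤ √M := Real.le_sqrt_of_sq_le (by linarith)
    rw [div_le_iff₀ hη0] at h1
    linarith
  refine ⟨M, by linarith, ?_⟩
  intro p x θstar ℓ grad hess t₀ Ω₀ θ Ω hx hgr hhs hcont hΩ0 hΩt0 hΩ hθ hP hA1 hA2 hsp ht0 hA4a
    hA4b hA5 hV0 hwarm
  rcases Nat.eq_zero_or_pos p with hp0 | hp
  · subst hp0
    have hz : ∀ t, θ t - θstar = 0 := fun t => Subsingleton.elim _ _
    refine ⟨fun t ht => ?_, ?_⟩
    · rw [hz t]
      refine ⟨?_, ?_, ?_⟩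
      · simp only [quadForm, inner_zero_left]
        norm_num
        positivity
      · rw [norm_zero]; positivity
      · rw [norm_zero]; exact hr.le
    · unfold texit
      rw [sInf_eq_top]
      rintro a ⟨t, -, -, ht⟩
      rw [hz t, norm_zero] at ht
      linarith
  have hceil := (Nat.ceil_le.1 hwarm)
  have hrate := fun s hs => rate_lemma (s := s) hp hx hM3 hη0 hMη hceil hs
  have hlog0 : 1 ≤ Real.log t₀ := (hrate t₀ le_rfl).1
  have ht00 : 1 ≤ t₀ := by
    by_contra h
    have : t₀ = 0 := by omega
    subst this
    norm_num at hlog0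
  have hp1 : (1:ℝ) ≤ p := by exact_mod_cast hp
  -- lower bounds on Ω
  have hlow : ∀ n, (∀ k < n, ‖θ (t₀ + k) - θstar‖ ≤ r) → ∀ v : Vec p,
      K₂ * (t₀ + n : ℕ) * ‖v‖ ^ 2 ≤ quadForm (Ω (t₀ + n)) v := by
    intro n hn v
    rw [Omega_sum hΩt0 hΩ n, quadForm_add_mat]
    have h1 := quadForm_nonneg hΩ0.posSemidef v
    have h2 := hA1 (t₀ + n) (ht0.trans (by push_cast; linarith [Nat.cast_nonneg (α := ℝ) n]))
      (fun s => if s ≤ t₀ then θ t₀ else θ (s - 1)) (by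
        intro s hs
        rw [Finset.mem_Icc] at hs
        split_ifs with h
        · exact hA5
        · have := hn (s - 1 - t₀) (by omega)
          rwa [show t₀ + (s - 1 - t₀) = s - 1 by omega] at this) v
    linarith
  have hherm : ∀ n, (Ω (t₀ + n)).IsHermitian := by
    intro n
    rw [Omega_sum hΩt0 hΩ n]
    refine hΩ0.isHermitian.add ?_
    refine Finset.sum_induction _ (fun A : Mat p => A.IsHermitian) (fun _ _ h h' => h.add h')
      Matrix.isHermitian_zero ?_
    intro s _
    exact hess_symm (hgr s) (hhs s) _
  have hpd : ∀ n, (∀ k < n, ‖θ (t₀ + k) - θstar‖ ≤ r) → (Ω (t₀ + n)).PosDef := by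
    intro n hn
    refine posDef_of_quadForm (hherm n) fun v hv => lt_of_lt_of_le ?_ (hlow n hn v)
    have : 0 < ((t₀ + n : ℕ) : ℝ) := by exact_mod_cast (by omega)
    have : 0 < ‖v‖ := norm_pos_iff.2 hv
    positivity
  -- consequences of a bound on V
  have hcons : ∀ n, (∀ k < n, ‖θ (t₀ + k) - θstar‖ ≤ r) →
      quadForm (Ω (t₀ + n)) (θ (t₀ + n) - θstar) ≤ 2 * B * (p * Real.log (t₀ + n : ℕ) + x) →
      ‖θ (t₀ + n) - θstar‖ ^ 2 * (t₀ + n : ℕ) ≤ D * (p * Real.log (t₀ + n : ℕ) + x) ∧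
      ‖θ (t₀ + n) - θstar‖ * √√((t₀ + n : ℕ):ℝ) ≤ τ * √√(t₀:ℝ) ∧
      ‖θ (t₀ + n) - θstar‖ ≤ r := by
    intro n hn hV
    set δ := ‖θ (t₀ + n) - θstar‖ with hδ
    have hδ0 : 0 ≤ δ := norm_nonneg _
    have h1 := hlow n hn (θ (t₀ + n) - θstar)
    set m : ℝ := ((t₀ + n : ℕ) : ℝ) with hm
    have hm0 : 0 < m := by rw [hm]; exact_mod_cast (by omega)
    have htm : (t₀ : ℝ) ≤ m := by rw [hm]; push_cast; linarith [Nat.cast_nonneg (α := ℝ) n]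
    have ht0' : (0:ℝ) < t₀ := by exact_mod_cast ht00
    have hr1 := (hrate (t₀ + n) (by omega)).2
    rw [← hm] at hr1
    have h2 : δ ^ 2 * m ≤ D * (p * Real.log m + x) := by
      rw [hD, div_mul_eq_mul_div, le_div_iff₀ hK2]
      linarith
    have h3 : δ ^ 2 * m ≤ τ ^ 2 * (√m * √(t₀:ℝ)) := by
      rw [← hDη, mul_assoc]
      exact h2.trans (by gcongr)
    have hwm : √√m ^ 2 = √m := Real.sq_sqrt (Real.sqrt_nonneg _)
    have hw0 : √√(t₀:ℝ) ^ 2 = √(t₀:ℝ) := Real.sq_sqrt (Real.sqrt_nonneg _)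
    have hmm : √m * √m = m := Real.mul_self_sqrt hm0.le
    have hsm : 0 < √m := Real.sqrt_pos.2 hm0
    have h4 : δ ^ 2 * √m ≤ τ ^ 2 * √(t₀:ℝ) := by
      refine le_of_mul_le_mul_right ?_ hsm
      calc δ ^ 2 * √m * √m = δ ^ 2 * m := by rw [mul_assoc, hmm]
        _ ≤ _ := h3
        _ = _ := by ring
    refine ⟨h2, ?_, ?_⟩
    · refine le_of_sq_le_sq_aux ?_ (by positivity)
      rw [mul_pow, mul_pow, hwm, hw0]; exact h4
    · refine le_trans ?_ hτr
      refine le_of_sq_le_sq_aux ?_ hτ0.le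
      have h5 : √(t₀:ℝ) ≤ √m := Real.sqrt_le_sqrt htm
      refine le_of_mul_le_mul_right ?_ hsm
      exact h4.trans (by gcongr)
  -- main induction
  have hmain : ∀ n, quadForm (Ω (t₀ + n)) (θ (t₀ + n) - θstar)
        ≤ 2 * B * (p * Real.log (t₀ + n : ℕ) + x) ∧ ‖θ (t₀ + n) - θstar‖ ≤ r := by
    intro n
    induction n using Nat.strong_induction_on with
    | _ n ih =>
    have hin : ∀ k < n, ‖θ (t₀ + k) - θstar‖ ≤ r := fun k hk => (ih k hk).2
    suffices hV : quadForm (Ω (t₀ + n)) (θ (t₀ + n) - θstar)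
        ≤ 2 * B * (p * Real.log (t₀ + n : ℕ) + x) from ⟨hV, (hcons n hin hV).2.2⟩
    have hlogn : ∀ k ≤ n, Real.log (t₀ + k : ℕ) ≤ Real.log (t₀ + n : ℕ) := by
      intro k hk
      refine Real.log_le_log (by exact_mod_cast (by omega)) (by exact_mod_cast (by omega))
    have hlog1 : 1 ≤ Real.log (t₀ + n : ℕ) := hlog0.trans (hlogn 0 (by omega))
    rcases Nat.eq_zero_or_pos n with hn0 | hn0
    · subst hn0
      simp only [add_zero] at hlog1 ⊢
      have : (p:ℝ) ≤ p * Real.log t₀ := by nlinarith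
      calc _ ≤ C₀ * (p + x) := hV0
        _ ≤ C₀ * (p * Real.log t₀ + x) := by gcongr
        _ ≤ _ := by
          apply mul_le_mul_of_nonneg_right _ (by positivity)
          rw [hB]; linarith
    have hS := hsum_step hL1 hgr hΩ hθ hP hA2 hsp n
      (fun k hk => hpd k (fun j hj => hin j (by omega))) hin
    have hS1 := hA4a (t₀ + n) (by omega)
    have hS2 := hA4b (t₀ + n) (by omega) (by
      unfold texit
      refine le_sInf ?_
      rintro a ⟨t, rfl, htt, htr⟩
      by_contra hlt
      push Not at hlt
      have hlt' : t < t₀ + n := by exact_mod_cast hlt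
      have := hin (t - t₀) (by omega)
      rw [show t₀ + (t - t₀) = t by omega] at this
      linarith)
    set lt := Real.log (t₀ + n : ℕ) with hlt
    set a := p * lt + x with ha
    have hplt : (p:ℝ) ≤ p * lt := by nlinarith
    have hplt2 : lt ≤ p * lt := by nlinarith
    have ha0 : 0 < a := by positivity
    have hw00 : 0 < √√(t₀:ℝ) := by positivity
    have hrem : ∑ s ∈ Finset.Icc (t₀ + 1) (t₀ + n), ‖θ (s - 1) - θstar‖ ^ 3 ≤ 8 * D * τ * a := by
      have hterm : ∀ s ∈ Finset.Icc (t₀ + 1) (t₀ + n), ‖θ (s - 1) - θstar‖ ^ 3 ≤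
          (D * a * τ * √√(t₀:ℝ)) * (1 / (((s - 1 : ℕ):ℝ) * √√((s - 1 : ℕ):ℝ))) := by
        intro s hs
        rw [Finset.mem_Icc] at hs
        obtain ⟨k, hk⟩ : ∃ k, s - 1 = t₀ + k := ⟨s - 1 - t₀, by omega⟩
        rw [hk]
        have hkn : k < n := by omega
        obtain ⟨h1, h2, -⟩ := hcons k (fun j hj => hin j (by omega)) (ih k hkn).1
        set δ := ‖θ (t₀ + k) - θstar‖
        have hδ0 : 0 ≤ δ := norm_nonneg _
        have hm0 : 0 < ((t₀ + k : ℕ) : ℝ) := by exact_mod_cast (by omega)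
        set m : ℝ := ((t₀ + k : ℕ) : ℝ)
        have hlm : Real.log m ≤ lt := hlogn k (by omega)
        have h1' : δ ^ 2 * m ≤ D * a := h1.trans (by rw [ha]; gcongr)
        have hw : 0 < √√m := by positivity
        rw [mul_one_div, le_div_iff₀ (by positivity)]
        calc δ ^ 3 * (m * √√m) = (δ ^ 2 * m) * (δ * √√m) := by ring
          _ ≤ (D * a) * (τ * √√(t₀:ℝ)) := by gcongr
          _ = _ := by ring
      refine (Finset.sum_le_sum hterm).trans ?_
      rw [← Finset.mul_sum]
      have hws := w_sum t₀ n ht00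
      have : 0 ≤ 8 / √√((t₀ + n : ℕ):ℝ) := by positivity
      calc _ ≤ (D * a * τ * √√(t₀:ℝ)) * (8 / √√(t₀:ℝ)) := by
            gcongr; linarith
        _ = _ := by field_simp
    have hrem2 : L₁ * L₂ * ∑ s ∈ Finset.Icc (t₀ + 1) (t₀ + n), ‖θ (s - 1) - θstar‖ ^ 3 ≤ B * a := by
      calc _ ≤ L₁ * L₂ * (8 * D * τ * a) := by gcongr
        _ = L₁ * L₂ * (8 * D * τ) * a := by ring
        _ ≤ _ := by gcongr
    have h1 : C₀ * (p + x) ≤ C₀ * a := by rw [ha]; gcongr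
    have h2 : 2 * (K₃ * x) ≤ 2 * K₃ * a := by
      have : x ≤ a := by rw [ha]; linarith
      nlinarith
    have h3 : K₄ * p * lt ≤ K₄ * a := by
      rw [mul_assoc]
      have : p * lt ≤ a := by rw [ha]; linarith
      gcongr
    have h4 : K₅ * (x + lt) ≤ K₅ * a := by
      have : x + lt ≤ a := by rw [ha]; linarith
      gcongr
    have hBa : B * a = C₀ * a + 2 * K₃ * a + K₄ * a + K₅ * a := by rw [hB]; ring
    linarith
  refine ⟨?_, ?_⟩
  · intro t ht
    obtain ⟨n, rfl⟩ := Nat.exists_eq_add_of_le ht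
    obtain ⟨hV, hR⟩ := hmain n
    obtain ⟨h1, -, -⟩ := hcons n (fun k _ => (hmain k).2) hV
    have hm0 : 0 < ((t₀ + n : ℕ) : ℝ) := by exact_mod_cast (by omega)
    have hlg : 0 ≤ Real.log (t₀ + n : ℕ) := Real.log_natCast_nonneg _
    set a := p * Real.log (t₀ + n : ℕ) + x with ha
    have ha0 : 0 < a := by positivity
    refine ⟨hV.trans ?_, ?_, hR⟩
    · apply mul_le_mul_of_nonneg_right _ ha0.le
      linarith
    · refine le_of_sq_le_sq_aux ?_ (by positivity)
      rw [mul_pow, Real.sq_sqrt (by positivity), ← mul_div_assoc, le_div_iff₀ hm0]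
      refine h1.trans ?_
      gcongr
      nlinarith
  · unfold texit
    rw [sInf_eq_top]
    rintro a ⟨t, -, ht, htr⟩
    obtain ⟨n, rfl⟩ := Nat.exists_eq_add_of_le ht.le
    linarith [(hmain n).2]
end
end

section
/- Total variation bound between Gaussian measures: let μ₁, μ₂ ∈ R^p and let Ω₁, Ω₂ be symmetric positive definite p × p matrices with ‖Ω₂^{−1/2} Ω₁ Ω₂^{−1/2} − I_p‖₂ ≤ 0.684. Then d_V( N(μ₁, Ω₁^{−1}), N(μ₂, Ω₂^{−1}) ) ≤ ½ ( ‖Ω₁^{1/2}(μ₁ − μ₂)‖₂² + ‖Ω₂^{−1/2} Ω₁ Ω₂^{−1/2} − I_p‖_F² )^{1/2}, where ‖·‖_F is the Frobenius norm. -/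
open Matrix MeasureTheory Real
open scoped RealInnerProductSpace BigOperators ENNReal

noncomputable section

/-- `F_{t,θ} = Σ_{s=1}^{t} ∇²ℓ_s(θ)`. -/
def Fmat {p : ℕ} (hess : ℕ → Vec p → Mat p) (t : ℕ) (y : Vec p) : Mat p :=
  ∑ s ∈ Finset.Icc 1 t, hess s y

/-- The approximation rate `ε_{app,t} = √( (log(t/t₀))²(p log t + x)² / t )`. -/
def epsApp (t₀ p : ℕ) (x : ℝ) (t : ℕ) : ℝ :=
  Real.sqrt ((Real.log ((t : ℝ) / (t₀ : ℝ))) ^ 2 * ((p : ℝ) * Real.log t + x) ^ 2 / t)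

/-- The Frobenius norm of a matrix. -/
def frobNorm {p : ℕ} (A : Mat p) : ℝ := Real.sqrt (∑ i, ∑ j, A i j ^ 2)

/-- The density of the Gaussian measure on `ℝ^p` with mean `m` and *precision*
(inverse covariance) matrix `Q`. -/
def gaussianPDF {p : ℕ} (m : Vec p) (Q : Mat p) (v : Vec p) : ℝ :=
  Real.sqrt Q.det / Real.sqrt ((2 * Real.pi) ^ p) *
    Real.exp (-(1 / 2) * quadForm Q (v - m))

/-- The Gaussian measure `N(m, Q⁻¹)` on `ℝ^p`, parametrized by its precision
matrix `Q`. -/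
def gaussianOfPrec {p : ℕ} (m : Vec p) (Q : Mat p) : Measure (Vec p) :=
  MeasureTheory.volume.withDensity fun v => ENNReal.ofReal (gaussianPDF m Q v)

/-- Total variation distance `d_V(P,Q) = sup_A |P(A) − Q(A)|` over measurable
sets `A`. -/
def tvDist {α : Type*} [MeasurableSpace α] (P Q : Measure α) : ℝ :=
  ⨆ s : {s : Set α // MeasurableSet s}, |(P s.1).toReal - (Q s.1).toReal|


lemma aux_log_bound {x : ℝ} (h : -0.684 ≤ x) : x - Real.log (1 + x) ≤ x ^ 2 + x ^ 4 / 18 := by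
  have hp : 0 < 1 + x := by norm_num at h ⊢; linarith
  rcases le_total 0 x with hx | hx
  · have h1 := Real.one_sub_inv_le_log_of_pos hp
    have h2 : x - (1 - (1 + x)⁻¹) ≤ x ^ 2 := by
      have : x - (1 - (1 + x)⁻¹) = x ^ 2 * (1 + x)⁻¹ := by field_simp; ring
      rw [this]
      have : (1 + x)⁻¹ ≤ 1 := inv_le_one_of_one_le₀ (by linarith)
      nlinarith [sq_nonneg x]
    have : 0 ≤ x ^ 4 / 18 := by positivity
    linarith
  · obtain ⟨y, rfl⟩ : ∃ y, x = -y := ⟨-x, by ring⟩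
    have hy0 : 0 ≤ y := by linarith
    have hy1 : y ≤ 0.684 := by linarith
    have hy2 : |y| < 1 := by rw [abs_of_nonneg hy0]; norm_num at hy1 ⊢; linarith
    have h1 := Real.abs_log_sub_add_sum_range_le hy2 20
    rw [abs_of_nonneg hy0] at h1
    have h2 := (abs_le.1 h1).1
    have hr : y ^ 21 / (1 - y) ≤ y ^ 21 / 0.316 := by
      apply div_le_div_of_nonneg_left (by positivity) (by norm_num)
      norm_num at hy1 ⊢; linarith
    have key : ∀ k : ℕ, y ^ (k + 2) ≤ y ^ 2 * 0.684 ^ k := fun k => by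
      rw [pow_add, mul_comm]
      gcongr
    have k1 := key 1
    have k2 := key 2
    have k3 := key 3
    have k4 := key 4
    have k5 := key 5
    have k6 := key 6
    have k7 := key 7
    have k8 := key 8
    have k9 := key 9
    have k10 := key 10
    have k11 := key 11
    have k12 := key 12
    have k13 := key 13
    have k14 := key 14
    have k15 := key 15
    have k16 := key 16
    have k17 := key 17
    have k18 := key 18
    have k19 := key 19
    have hy3 : 0 ≤ y ^ 2 := by positivity
    simp only [Finset.sum_range_succ, Finset.sum_range_zero] at h2
    norm_num at *
    have e : (1:ℝ) + -y = 1 - y := by ring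
    have e4 : (-y) ^ 4 = y ^ 4 := by ring
    try rw [e]
    linarith

lemma aux_binary {a b : ℝ} (ha : 0 < a) (ha1 : a < 1) (hb : 0 < b) (hb1 : b < 1) :
    2 * (a - b) ^ 2 + 4 / 9 * (a - b) ^ 4 ≤
      a * (Real.log a - Real.log b) + (1 - a) * (Real.log (1 - a) - Real.log (1 - b)) := by
  set F : ℝ → ℝ := fun t => a * (Real.log a - Real.log t)
    + (1 - a) * (Real.log (1 - a) - Real.log (1 - t))
    - (2 * (t - a) ^ 2 + 16 * ((t - a) ^ 4 / 4 + 2 * (a - 1 / 2) * (t - a) ^ 3 / 3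
      + (a - 1 / 2) ^ 2 * (t - a) ^ 2 / 2)) with hF
  have hd : ∀ t, 0 < t → t < 1 → HasDerivAt F
      ((t - a) * (1 / (t * (1 - t)) - (4 + 16 * (t - 1 / 2) ^ 2))) t := by
    intro t h0 h1
    have h1' : 1 - t ≠ 0 := by linarith
    have e0 : HasDerivAt (fun t : ℝ => t - a) 1 t := (hasDerivAt_id t).sub_const a
    have e1 := (Real.hasDerivAt_log h0.ne').const_sub (Real.log a)
    have e2 := (((hasDerivAt_id t).const_sub 1).log h1').const_sub (Real.log (1 - a))
    have := ((e1.const_mul a).add (e2.const_mul (1 - a))).sub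
      (((e0.pow 2).const_mul 2).add (((((e0.pow 4).div_const 4).add
        (((e0.pow 3).const_mul (2 * (a - 1 / 2))).div_const 3)).add
        (((e0.pow 2).const_mul ((a - 1 / 2) ^ 2)).div_const 2)).const_mul 16))
    refine this.congr_deriv ?_
    simp only [id]
    field_simp
    ring
  have hs : ∀ t : ℝ, 0 < t → t < 1 → 0 ≤ 1 / (t * (1 - t)) - (4 + 16 * (t - 1 / 2) ^ 2) := by
    intro t h0 h1
    have hpos : 0 < t * (1 - t) := mul_pos h0 (by linarith)
    rw [sub_nonneg, le_div_iff₀ hpos]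
    nlinarith [sq_nonneg ((t - 1 / 2) ^ 2)]
  have hFa : F a = 0 := by simp [hF]
  have hFb : 0 ≤ F b := by
    rcases le_total a b with hab | hab
    · have : MonotoneOn F (Set.Icc a b) := by
        apply monotoneOn_of_deriv_nonneg (convex_Icc a b)
        · intro t ht
          exact (hd t (by linarith [ht.1]) (by linarith [ht.2])).continuousAt.continuousWithinAt
        · intro t ht
          rw [interior_Icc] at ht
          exact (hd t (by linarith [ht.1]) (by linarith [ht.2])).differentiableAt.differentiableWithinAt
        · intro t ht
          rw [interior_Icc] at ht
          rw [(hd t (by linarith [ht.1]) (by linarith [ht.2])).deriv]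
          exact mul_nonneg (by linarith [ht.1]) (hs t (by linarith [ht.1]) (by linarith [ht.2]))
      rw [← hFa]
      exact this (Set.left_mem_Icc.2 hab) (Set.right_mem_Icc.2 hab) hab
    · have : AntitoneOn F (Set.Icc b a) := by
        apply antitoneOn_of_deriv_nonpos (convex_Icc b a)
        · intro t ht
          exact (hd t (by linarith [ht.1]) (by linarith [ht.2])).continuousAt.continuousWithinAt
        · intro t ht
          rw [interior_Icc] at ht
          exact (hd t (by linarith [ht.1]) (by linarith [ht.2])).differentiableAt.differentiableWithinAt
        · intro t ht
          rw [interior_Icc] at ht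
          rw [(hd t (by linarith [ht.1]) (by linarith [ht.2])).deriv]
          exact mul_nonpos_of_nonpos_of_nonneg (by linarith [ht.2])
            (hs t (by linarith [ht.1]) (by linarith [ht.2]))
      rw [← hFa]
      exact this (Set.left_mem_Icc.2 hab) (Set.right_mem_Icc.2 hab) hab
  simp only [hF] at hFb
  nlinarith [mul_nonneg (sq_nonneg (b - a)) (sq_nonneg (3 * (a - 1 / 2) + 2 * (b - a)))]

lemma aux_half {α : Type*} [MeasurableSpace α] (P Q : Measure α) [IsProbabilityMeasure P]
    [IsProbabilityMeasure Q] (r : α → ℝ) (hr : Measurable r) (hr0 : ∀ x, 0 < r x)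
    (hQ : Q = P.withDensity fun x => ENNReal.ofReal (r x))
    (hL : Integrable (fun x => -Real.log (r x)) P) (A : Set α) (hA : MeasurableSet A)
    (c : ℝ) (hc : 0 < c) :
    P.real A - c * Q.real A ≤ (∫ x in A, -Real.log (r x) ∂P) - Real.log c * P.real A := by
  have hint : Integrable r P := by
    refine ⟨hr.aestronglyMeasurable, ?_⟩
    rw [hasFiniteIntegral_iff_ofReal (Filter.Eventually.of_forall fun x => (hr0 x).le)]
    have : Q Set.univ = 1 := measure_univ
    rw [hQ, withDensity_apply _ MeasurableSet.univ, Measure.restrict_univ] at this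
    rw [this]; exact ENNReal.one_lt_top
  have hQA : Q.real A = ∫ x in A, r x ∂P := by
    rw [integral_eq_lintegral_of_nonneg_ae (Filter.Eventually.of_forall fun x => (hr0 x).le)
      hr.aestronglyMeasurable, Measure.real, hQ, withDensity_apply _ hA]
  have h1 : P.real A = ∫ x in A, (1 : ℝ) ∂P := by simp
  have h2 : Real.log c * P.real A = ∫ x in A, Real.log c ∂P := by simp [mul_comm]
  rw [h2, hQA, ← integral_const_mul, h1, ← integral_sub, ← integral_sub]
  · apply integral_mono
    · exact ((integrable_const _).sub (hint.const_mul c)).integrableOn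
    · exact (hL.sub (integrable_const _)).integrableOn
    · intro x
      have := Real.log_le_sub_one_of_pos (mul_pos hc (hr0 x))
      rw [Real.log_mul hc.ne' (hr0 x).ne'] at this
      simp only
      linarith
  · exact hL.integrableOn
  · exact integrable_const _
  · exact integrable_const _
  · exact (hint.const_mul c).integrableOn

lemma aux_pinsker {α : Type*} [MeasurableSpace α] (P Q : Measure α) [IsProbabilityMeasure P]
    [IsProbabilityMeasure Q] (r : α → ℝ) (hr : Measurable r) (hr0 : ∀ x, 0 < r x)
    (hQ : Q = P.withDensity fun x => ENNReal.ofReal (r x))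
    (hL : Integrable (fun x => -Real.log (r x)) P) (A : Set α) (hA : MeasurableSet A) :
    2 * (P.real A - Q.real A) ^ 2 + 4 / 9 * (P.real A - Q.real A) ^ 4
      ≤ ∫ x, -Real.log (r x) ∂P := by
  have hiff : ∀ B : Set α, MeasurableSet B → (P.real B = 0 ↔ Q.real B = 0) := by
    intro B hB
    rw [measureReal_eq_zero_iff, measureReal_eq_zero_iff, hQ,
      withDensity_apply_eq_zero (by fun_prop)]
    have : {x | ENNReal.ofReal (r x) ≠ 0} ∩ B = B := by
      ext x; simp [hr0 x]
    rw [this]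
  have half := aux_half P Q r hr hr0 hQ hL
  have hPc : P.real Aᶜ = 1 - P.real A := by
    rw [measureReal_compl hA]; simp
  have hQc : Q.real Aᶜ = 1 - Q.real A := by
    rw [measureReal_compl hA]; simp
  have hsum := integral_add_compl hA hL
  have hi1 := hiff A hA
  have hi2 := hiff Aᶜ hA.compl
  rw [hPc, hQc] at hi2
  have a0 : 0 ≤ P.real A := measureReal_nonneg
  have b0 : 0 ≤ Q.real A := measureReal_nonneg
  have a1 : P.real A ≤ 1 := measureReal_le_one
  have b1 : Q.real A ≤ 1 := measureReal_le_one
  have hA1 := half A hA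
  have hA2 := half Aᶜ hA.compl
  rw [hPc, hQc] at hA2
  generalize P.real A = a at *
  generalize Q.real A = b at *
  rw [← hsum]
  by_cases ha : a = 0
  · have hb : b = 0 := hi1.1 ha
    have := hA1 1 one_pos
    have := hA2 1 one_pos
    subst ha hb
    simp at *
    linarith
  by_cases ha' : 1 - a = 0
  · have hb : 1 - b = 0 := hi2.1 ha'
    have e1 : a = 1 := by linarith
    have e2 : b = 1 := by linarith
    have := hA1 1 one_pos
    have := hA2 1 one_pos
    subst e1 e2
    simp at *
    linarith
  have hb : b ≠ 0 := fun h => ha (hi1.2 h)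
  have hb' : 1 - b ≠ 0 := fun h => ha' (hi2.2 h)
  have pa : 0 < a := lt_of_le_of_ne a0 (Ne.symm ha)
  have pb : 0 < b := lt_of_le_of_ne b0 (Ne.symm hb)
  have pa' : 0 < 1 - a := lt_of_le_of_ne (by linarith) (Ne.symm ha')
  have pb' : 0 < 1 - b := lt_of_le_of_ne (by linarith) (Ne.symm hb')
  have q1 := hA1 (a / b) (by positivity)
  have q2 := hA2 ((1 - a) / (1 - b)) (by positivity)
  rw [div_mul_cancel₀ _ hb, Real.log_div ha hb] at q1
  rw [div_mul_cancel₀ _ hb', Real.log_div ha' hb'] at q2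
  have := aux_binary pa (by linarith) pb (by linarith)
  linarith

lemma aux_mat {p : ℕ} (C : Mat p) (hC : C.IsHermitian) (hs : specNorm C ≤ 0.684) :
    C.trace - Real.log (1 + C).det ≤ frobNorm C ^ 2 + (frobNorm C ^ 2) ^ 2 / 18 := by
  set l := hC.eigenvalues with hl
  have hlb : ∀ i, -0.684 ≤ l i := by
    intro i
    have h1 := ContinuousLinearMap.le_opNorm
      (LinearMap.toContinuousLinearMap (Matrix.toEuclideanLin C)) (hC.eigenvectorBasis i)
    have h2 : (LinearMap.toContinuousLinearMap (Matrix.toEuclideanLin C)) (hC.eigenvectorBasis i)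
        = l i • hC.eigenvectorBasis i := by
      have := hC.mulVec_eigenvectorBasis i
      ext j
      simpa [Matrix.toLpLin_apply] using congrFun this j
    rw [h2, norm_smul, hC.eigenvectorBasis.orthonormal.1 i, mul_one, mul_one] at h1
    have h3 : ‖l i‖ ≤ 0.684 := h1.trans hs
    rw [Real.norm_eq_abs] at h3
    linarith [(abs_le.1 h3).1]
  have hsp := hC.spectral_theorem
  rw [Unitary.conjStarAlgAut_apply] at hsp
  set U : Mat p := (hC.eigenvectorUnitary : Mat p) with hU
  have hUU : star U * U = 1 := Unitary.coe_star_mul_self hC.eigenvectorUnitary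
  have hUU' : U * star U = 1 := Unitary.coe_mul_star_self hC.eigenvectorUnitary
  have hsp' : C = U * diagonal l * star U := by
    simpa using hsp
  have htr : C.trace = ∑ i, l i := by simpa using hC.trace_eq_sum_eigenvalues
  have hdet : (1 + C).det = ∏ i, (1 + l i) := by
    have : 1 + C = U * diagonal (fun i => 1 + l i) * star U := by
      have e : diagonal (fun i => 1 + l i) = 1 + diagonal l := by
        rw [← diagonal_one, diagonal_add]
      rw [e, mul_add, add_mul, mul_one, hUU', ← hsp']
    rw [this, det_mul_right_comm, hUU', one_mul, det_diagonal]
  have hfrob : frobNorm C ^ 2 = ∑ i, l i ^ 2 := by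
    rw [frobNorm, Real.sq_sqrt (by positivity)]
    have h1 : ∑ i, ∑ j, C i j ^ 2 = (C * C).trace := by
      simp only [trace, diag_apply, mul_apply]
      refine Finset.sum_congr rfl fun i _ => Finset.sum_congr rfl fun j _ => ?_
      have : C j i = C i j := by simpa using hC.apply i j
      rw [this, sq]
    have h2 : C * C = U * (diagonal l * diagonal l) * star U := by
      conv_lhs => rw [hsp']
      calc _ = U * diagonal l * (star U * U) * diagonal l * star U := by noncomm_ring
        _ = _ := by rw [hUU]; noncomm_ring
    rw [h1, h2, trace_mul_comm, ← mul_assoc, hUU, one_mul, diagonal_mul_diagonal, trace_diagonal]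
    simp [sq]
  have hpos : ∀ i, 1 + l i ≠ 0 := fun i => by have := hlb i; norm_num at this; linarith
  rw [hdet, htr, hfrob, Real.log_prod (fun i _ => hpos i), ← Finset.sum_sub_distrib]
  calc _ ≤ ∑ i, (l i ^ 2 + l i ^ 4 / 18) := Finset.sum_le_sum fun i _ => aux_log_bound (hlb i)
    _ = ∑ i, l i ^ 2 + (∑ i, (l i ^ 2) ^ 2) / 18 := by
        rw [Finset.sum_add_distrib, Finset.sum_div]
        congr 1
        exact Finset.sum_congr rfl fun i _ => by ring
    _ ≤ _ := by
        gcongr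
        exact Finset.sum_sq_le_sq_sum_of_nonneg fun i _ => sq_nonneg _

lemma quadForm_eq_sum {p : ℕ} (A : Mat p) (v : Vec p) :
    quadForm A v = ∑ i, ∑ j, A i j * (v i * v j) := by
  simp only [quadForm, mApp, PiLp.inner_apply, Matrix.toLpLin_apply, mulVec, dotProduct,
    RCLike.inner_apply, conj_trivial, Finset.sum_mul]
  refine Finset.sum_congr rfl fun i _ => Finset.sum_congr rfl fun j _ => ?_
  ring

lemma quadForm_one {p : ℕ} (v : Vec p) : quadForm (1 : Mat p) v = ‖v‖ ^ 2 := by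
  simp [quadForm, mApp]

lemma mApp_mul {p : ℕ} (A B : Mat p) (v : Vec p) : mApp (A * B) v = mApp A (mApp B v) := by
  simp [mApp, Matrix.toLpLin_mul_same]

lemma inner_mApp_symm {p : ℕ} (A : Mat p) (hA : A.IsHermitian) (v w : Vec p) :
    ⟪mApp A v, w⟫ = ⟪v, mApp A w⟫ := by
  exact (Matrix.isSymmetric_toEuclideanLin_iff.2 hA) v w

lemma quadForm_mApp {p : ℕ} (A S : Mat p) (hS : S.IsHermitian) (v : Vec p) :
    quadForm A (mApp S v) = quadForm (S * A * S) v := by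
  rw [quadForm, quadForm, inner_mApp_symm S hS, mApp_mul, mApp_mul]

lemma continuous_mApp {p : ℕ} (A : Mat p) : Continuous (mApp A) :=
  (LinearMap.toContinuousLinearMap (Matrix.toEuclideanLin A)).continuous

lemma continuous_gaussianPDF {p : ℕ} (m : Vec p) (Q : Mat p) : Continuous (gaussianPDF m Q) := by
  unfold gaussianPDF quadForm
  have := continuous_mApp Q
  fun_prop

lemma gaussianPDF_pos {p : ℕ} (m : Vec p) (Q : Mat p) (hQ : Q.PosDef) (v : Vec p) :
    0 < gaussianPDF m Q v := by
  have := hQ.det_pos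
  unfold gaussianPDF
  positivity

lemma gauss_std_pdf {p : ℕ} (v : Vec p) : gaussianPDF 0 1 v =
    (Real.sqrt ((2 * Real.pi) ^ p))⁻¹ * Real.exp (-(1 / 2) * ‖v‖ ^ 2) := by
  simp [gaussianPDF, quadForm_one]

lemma gauss_std_integral {p : ℕ} : ∫ v : Vec p, Real.exp (-(1 / 2) * ‖v‖ ^ 2)
    = Real.sqrt ((2 * Real.pi) ^ p) := by
  rw [GaussianFourier.integral_rexp_neg_mul_sq_norm (by norm_num : (0:ℝ) < 1 / 2)]
  rw [Real.sqrt_eq_rpow, ← Real.rpow_natCast, ← Real.rpow_mul (by positivity)]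
  simp
  ring_nf

lemma gauss_std {p : ℕ} : gaussianOfPrec (0 : Vec p) 1 = ProbabilityTheory.stdGaussian (Vec p) := by
  have hc : Real.sqrt ((2 * Real.pi) ^ p) ≠ 0 := by positivity
  have hint : Integrable (fun v : Vec p => Real.exp (-(1 / 2) * ‖v‖ ^ 2)) := by
    by_contra h
    have := gauss_std_integral (p := p)
    rw [integral_undef h] at this
    exact hc this.symm
  have hint2 : Integrable (gaussianPDF (0 : Vec p) 1) := by
    have := hint.const_mul (Real.sqrt ((2 * Real.pi) ^ p))⁻¹
    exact this.congr (Filter.Eventually.of_forall fun v => (gauss_std_pdf v).symm)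
  have hfin : IsFiniteMeasure (gaussianOfPrec (0 : Vec p) 1) :=
    isFiniteMeasure_withDensity_ofReal hint2.2
  apply Measure.ext_of_charFun
  ext t
  rw [ProbabilityTheory.charFun_stdGaussian, charFun_apply, gaussianOfPrec]
  rw [integral_withDensity_eq_integral_toReal_smul (by
    exact (continuous_gaussianPDF _ _).measurable.ennreal_ofReal) (by simp)]
  have h1 := GaussianFourier.integral_cexp_neg_mul_sq_norm_add (V := Vec p) (b := 1 / 2)
    (by norm_num) Complex.I t
  have h0 := GaussianFourier.integral_cexp_neg_mul_sq_norm (V := Vec p) (b := 1 / 2)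
    (by norm_num)
  rw [← h0] at h1
  have h2 : ∫ v : Vec p, Complex.exp (-(1 / 2) * ‖v‖ ^ 2) = (Real.sqrt ((2 * Real.pi) ^ p) : ℂ) := by
    rw [← gauss_std_integral, ← integral_complex_ofReal]
    congr 1; ext v; push_cast; rfl
  rw [h2] at h1
  have h3 : ∀ v : Vec p, (ENNReal.ofReal (gaussianPDF 0 1 v)).toReal • Complex.exp (⟪v, t⟫ * Complex.I)
      = ((Real.sqrt ((2 * Real.pi) ^ p) : ℂ))⁻¹ *
        Complex.exp (-(1 / 2) * ‖v‖ ^ 2 + Complex.I * ⟪t, v⟫) := by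
    intro v
    rw [ENNReal.toReal_ofReal (gaussianPDF_pos _ _ PosDef.one v).le, gauss_std_pdf,
      Complex.exp_add, real_inner_comm, Complex.real_smul]
    push_cast
    rw [mul_comm Complex.I]
    ring
  simp_rw [h3]
  rw [integral_const_mul, h1, ← mul_assoc, inv_mul_cancel₀ (by exact_mod_cast hc), one_mul,
    Complex.I_sq]
  congr 1
  ring

lemma gauss_map {p : ℕ} (m : Vec p) (Q S : Mat p) (hS : S.IsHermitian)
    (h : S * Q * S = 1) :
    gaussianOfPrec m Q = (gaussianOfPrec 0 1).map (fun w => m + mApp S w) := by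
  have hdet : S.det * Q.det * S.det = 1 := by
    rw [← det_mul, ← det_mul, h, det_one]
  have hdS : S.det ≠ 0 := by rintro h0; simp [h0] at hdet
  have habs : |S.det| * Real.sqrt Q.det = 1 := by
    rw [← Real.sqrt_sq_eq_abs, ← Real.sqrt_mul (sq_nonneg _)]
    rw [show S.det ^ 2 * Q.det = 1 by linarith, Real.sqrt_one]
  have hinv : S * S⁻¹ = 1 := mul_nonsing_inv _ (by simpa using hdS)
  have hinv' : S⁻¹ * S = 1 := nonsing_inv_mul _ (by simpa using hdS)
  have one_app : ∀ v : Vec p, mApp 1 v = v := fun v => by simp [mApp]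
  set T : Vec p → Vec p := fun w => m + mApp S w with hT
  have hTc : Continuous T := by
    have := continuous_mApp S
    fun_prop
  have hinj : Function.Injective T := by
    intro x y hxy
    have h1 : mApp S x = mApp S y := by simpa [hT] using hxy
    have := congrArg (mApp S⁻¹) h1
    rwa [← mApp_mul, ← mApp_mul, hinv', one_app, one_app] at this
  have hsurj : Function.Surjective T := fun y => ⟨mApp S⁻¹ (y - m), by
    simp only [hT]; rw [← mApp_mul, hinv, one_app]; simp⟩
  have hder : ∀ x, HasFDerivAt T (LinearMap.toContinuousLinearMap (Matrix.toEuclideanLin S)) x := by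
    intro x
    exact (LinearMap.toContinuousLinearMap (Matrix.toEuclideanLin S)).hasFDerivAt.const_add m
  ext s hs
  rw [Measure.map_apply hTc.measurable hs, gaussianOfPrec, gaussianOfPrec,
    withDensity_apply _ hs, withDensity_apply _ (hTc.measurable hs)]
  conv_lhs => rw [← Set.image_preimage_eq s hsurj]
  rw [lintegral_image_eq_lintegral_abs_det_fderiv_mul volume (hTc.measurable hs)
    (fun x _ => (hder x).hasFDerivWithinAt) hinj.injOn]
  refine lintegral_congr fun w => ?_
  rw [← ENNReal.ofReal_mul (abs_nonneg _)]
  congr 1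
  have hd : (LinearMap.toContinuousLinearMap (Matrix.toEuclideanLin S)).det = S.det := by
    rw [ContinuousLinearMap.det, LinearMap.coe_toContinuousLinearMap]
    simp
  rw [hd, gaussianPDF, gauss_std_pdf]
  simp only [hT, add_sub_cancel_left]
  rw [quadForm_mApp Q S hS, h, quadForm_one]
  linear_combination (Real.sqrt ((2 * Real.pi) ^ p))⁻¹ * Real.exp (-(1 / 2) * ‖w‖ ^ 2) * habs

lemma exists_root {p : ℕ} (Q : Mat p) (hQ : Q.PosDef) :
    ∃ S : Mat p, S.PosSemidef ∧ S * S = Q⁻¹ := by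
  open scoped MatrixOrder in
  exact ⟨CFC.sqrt Q⁻¹, (CFC.sqrt_nonneg _).posSemidef,
    CFC.sqrt_mul_sqrt_self _ hQ.inv.posSemidef.nonneg⟩

lemma root_conj {p : ℕ} (Q S : Mat p) (hQ : Q.PosDef) (hS : S * S = Q⁻¹) : S * Q * S = 1 := by
  rw [mul_eq_one_comm, ← mul_assoc, hS]
  exact nonsing_inv_mul _ (by simpa using hQ.det_pos.ne')

lemma gauss_prob {p : ℕ} (m : Vec p) (Q : Mat p) (hQ : Q.PosDef) :
    IsProbabilityMeasure (gaussianOfPrec m Q) := by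
  obtain ⟨S, hS, hSS⟩ := exists_root Q hQ
  rw [gauss_map m Q S hS.isHermitian (root_conj Q S hQ hSS), gauss_std]
  have := continuous_mApp S
  exact Measure.isProbabilityMeasure_map (by fun_prop)

lemma std_quad {p : ℕ} (A : Mat p) :
    Integrable (quadForm A) (ProbabilityTheory.stdGaussian (Vec p)) ∧
      ∫ w, quadForm A w ∂(ProbabilityTheory.stdGaussian (Vec p)) = A.trace := by
  have hm : ∀ i : Fin p, MemLp (fun w : Vec p => w i) 2 (ProbabilityTheory.stdGaussian (Vec p)) := by
    intro i
    exact ProbabilityTheory.IsGaussian.memLp_dual (ProbabilityTheory.stdGaussian (Vec p))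
      (EuclideanSpace.proj i) 2 (by simp)
  have hint : ∀ i j, Integrable (fun w : Vec p => w i * w j)
      (ProbabilityTheory.stdGaussian (Vec p)) := fun i j => (hm i).integrable_mul (hm j)
  have hmean : ∀ i, ∫ w : Vec p, w i ∂(ProbabilityTheory.stdGaussian (Vec p)) = 0 := fun i =>
    ProbabilityTheory.integral_strongDual_stdGaussian (E := Vec p) (EuclideanSpace.proj i)
  have hcov : ∀ i j, ∫ w : Vec p, w i * w j ∂(ProbabilityTheory.stdGaussian (Vec p))
      = (1 : Mat p) i j := by
    intro i j
    have h1 := ProbabilityTheory.covariance_eval_multivariateGaussian (μ := (0 : Vec p))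
      (S := (1 : Mat p)) PosSemidef.one i j
    rw [ProbabilityTheory.multivariateGaussian_zero_one,
      ProbabilityTheory.covariance_eq_sub (hm i) (hm j)] at h1
    rw [hmean, hmean] at h1
    simpa using h1
  have e : quadForm A = fun w => ∑ i, ∑ j, A i j * (w i * w j) := funext (quadForm_eq_sum A)
  rw [e]
  constructor
  · exact integrable_finsetSum _ fun i _ => integrable_finsetSum _ fun j _ =>
      (hint i j).const_mul _
  · have h1 : ∀ i, Integrable (fun w : Vec p => ∑ j, A i j * (w i * w j))
        (ProbabilityTheory.stdGaussian (Vec p)) := fun i =>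
      integrable_finsetSum _ fun j _ => (hint i j).const_mul _
    have h2 := integral_finsetSum (μ := ProbabilityTheory.stdGaussian (Vec p)) Finset.univ
      (fun i _ => h1 i)
    refine h2.trans ?_
    have h3 : ∀ i, ∫ w : Vec p, ∑ j, A i j * (w i * w j) ∂(ProbabilityTheory.stdGaussian (Vec p))
        = A i i := by
      intro i
      have h4 := integral_finsetSum (μ := ProbabilityTheory.stdGaussian (Vec p)) Finset.univ
        (fun j _ => (hint i j).const_mul (A i j))
      refine h4.trans ?_
      simp_rw [integral_const_mul, hcov]
      simp [Matrix.one_apply]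
    simp_rw [h3]
    rfl

lemma std_lin {p : ℕ} (u : Vec p) :
    Integrable (fun w => ⟪u, w⟫) (ProbabilityTheory.stdGaussian (Vec p)) ∧
      ∫ w, ⟪u, w⟫ ∂(ProbabilityTheory.stdGaussian (Vec p)) = 0 := by
  constructor
  · exact (ProbabilityTheory.IsGaussian.memLp_dual (ProbabilityTheory.stdGaussian (Vec p))
      (innerSL ℝ u) 1 (by simp)).integrable le_rfl
  · exact ProbabilityTheory.integral_strongDual_stdGaussian (E := Vec p) (innerSL ℝ u)

lemma log_gaussianPDF {p : ℕ} (m : Vec p) (Q : Mat p) (hQ : Q.PosDef) (v : Vec p) :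
    Real.log (gaussianPDF m Q v) = (1 / 2) * Real.log Q.det
      - Real.log (Real.sqrt ((2 * Real.pi) ^ p)) - (1 / 2) * quadForm Q (v - m) := by
  have h := hQ.det_pos
  have hc : Real.sqrt ((2 * Real.pi) ^ p) ≠ 0 := by positivity
  have hd : Real.sqrt Q.det ≠ 0 := by positivity
  rw [gaussianPDF, Real.log_mul (by positivity) (Real.exp_pos _).ne', Real.log_exp,
    Real.log_div hd hc, Real.log_sqrt h.le]
  ring

lemma gauss_tv_set {p : ℕ} (μ₁ μ₂ : Vec p) (Ω₁ Ω₂ : Mat p)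
    (h₁ : Ω₁.PosDef) (h₂ : Ω₂.PosDef) (S : Mat p) (hS : S.PosSemidef) (hSS : S * S = Ω₂⁻¹)
    (A : Set (Vec p)) (hA : MeasurableSet A) :
    2 * ((gaussianOfPrec μ₂ Ω₂).real A - (gaussianOfPrec μ₁ Ω₁).real A) ^ 2
      + 4 / 9 * ((gaussianOfPrec μ₂ Ω₂).real A - (gaussianOfPrec μ₁ Ω₁).real A) ^ 4
      ≤ (1 / 2) * ((S * Ω₁ * S - 1).trace - Real.log (1 + (S * Ω₁ * S - 1)).det
        + quadForm Ω₁ (μ₁ - μ₂)) := by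
  have hP := gauss_prob μ₂ Ω₂ h₂
  have hQ := gauss_prob μ₁ Ω₁ h₁
  have hconj := root_conj Ω₂ S h₂ hSS
  have hmap := gauss_map μ₂ Ω₂ S hS.isHermitian hconj
  rw [gauss_std] at hmap
  set r : Vec p → ℝ := fun v => gaussianPDF μ₁ Ω₁ v / gaussianPDF μ₂ Ω₂ v with hr
  have c1 := continuous_gaussianPDF μ₁ Ω₁
  have c2 := continuous_gaussianPDF μ₂ Ω₂
  have p1 := gaussianPDF_pos μ₁ Ω₁ h₁
  have p2 := gaussianPDF_pos μ₂ Ω₂ h₂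
  have hrm : Measurable r := c1.measurable.div c2.measurable
  have hrp : ∀ x, 0 < r x := fun x => div_pos (p1 x) (p2 x)
  have hQd : gaussianOfPrec μ₁ Ω₁
      = (gaussianOfPrec μ₂ Ω₂).withDensity fun x => ENNReal.ofReal (r x) := by
    rw [gaussianOfPrec, gaussianOfPrec, ← withDensity_mul _ c2.measurable.ennreal_ofReal
      hrm.ennreal_ofReal]
    congr 1
    ext v
    rw [Pi.mul_apply, ← ENNReal.ofReal_mul (p2 v).le]
    congr 1
    simp only [hr]
    field_simp [(p2 v).ne']
  set T : Vec p → Vec p := fun w => μ₂ + mApp S w with hT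
  have hTm : Measurable T := by
    have := continuous_mApp S
    exact (by fun_prop : Continuous T).measurable
  set u : Vec p := mApp S (mApp Ω₁ (μ₁ - μ₂)) with hu
  set k : ℝ := (1 / 2) * Real.log Ω₂.det - (1 / 2) * Real.log Ω₁.det
    + (1 / 2) * quadForm Ω₁ (μ₁ - μ₂) with hk
  have hlog : ∀ w, -Real.log (r (T w)) = (1 / 2) * quadForm (S * Ω₁ * S - 1) w - ⟪u, w⟫ + k := by
    intro w
    simp only [hr]
    rw [Real.log_div (p1 _).ne' (p2 _).ne', log_gaussianPDF _ _ h₁, log_gaussianPDF _ _ h₂]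
    have e2 : T w - μ₂ = mApp S w := by simp [hT]
    have e1 : T w - μ₁ = mApp S w - (μ₁ - μ₂) := by simp only [hT]; abel
    have e3 : quadForm Ω₁ (mApp S w - (μ₁ - μ₂)) = quadForm (S * Ω₁ * S) w - 2 * ⟪u, w⟫
        + quadForm Ω₁ (μ₁ - μ₂) := by
      rw [← quadForm_mApp _ _ hS.isHermitian]
      have hlin : ∀ x y, mApp Ω₁ (x - y) = mApp Ω₁ x - mApp Ω₁ y := fun x y => by simp [mApp]
      have a1 : ⟪u, w⟫ = ⟪mApp S w, mApp Ω₁ (μ₁ - μ₂)⟫ := by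
        rw [hu, real_inner_comm, inner_mApp_symm _ hS.isHermitian]
      have a2 : ⟪μ₁ - μ₂, mApp Ω₁ (mApp S w)⟫ = ⟪u, w⟫ := by
        rw [a1, ← inner_mApp_symm _ h₁.isHermitian, real_inner_comm]
      simp only [quadForm]
      rw [hlin, inner_sub_left, inner_sub_right, inner_sub_right, a2, ← a1]
      ring
    have e4 : quadForm (S * Ω₁ * S - 1) w = quadForm (S * Ω₁ * S) w - quadForm 1 w := by
      simp [quadForm, mApp, inner_sub_right]
    rw [e1, e2, e3, e4, quadForm_mApp _ _ hS.isHermitian, hconj]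
    ring
  have q := std_quad (S * Ω₁ * S - 1)
  have l := std_lin u
  have hmeas : AEStronglyMeasurable (fun x => -Real.log (r x))
      ((ProbabilityTheory.stdGaussian (Vec p)).map T) :=
    (hrm.log.neg).aestronglyMeasurable
  have hL : Integrable (fun x => -Real.log (r x)) (gaussianOfPrec μ₂ Ω₂) := by
    rw [hmap, integrable_map_measure hmeas hTm.aemeasurable]
    refine (((q.1.const_mul (1 / 2)).sub l.1).add (integrable_const k)).congr
      (Filter.Eventually.of_forall fun w => ?_)
    exact (hlog w).symm
  have hI : ∫ x, -Real.log (r x) ∂(gaussianOfPrec μ₂ Ω₂)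
      = (1 / 2) * (S * Ω₁ * S - 1).trace + k := by
    rw [hmap, integral_map hTm.aemeasurable hmeas]
    simp_rw [hlog]
    have hi : Integrable (fun w => 1 / 2 * quadForm (S * Ω₁ * S - 1) w - ⟪u, w⟫)
      (ProbabilityTheory.stdGaussian (Vec p)) := (q.1.const_mul (1 / 2)).sub l.1
    rw [integral_add hi (integrable_const k),
      integral_sub (q.1.const_mul (1 / 2)) l.1, integral_const_mul, q.2, l.2]
    simp
  have hfin := aux_pinsker _ _ r hrm hrp hQd hL A hA
  rw [hI] at hfin
  refine hfin.trans (le_of_eq ?_)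
  have hd : (1 + (S * Ω₁ * S - 1)).det = Ω₁.det / Ω₂.det := by
    rw [add_sub_cancel, det_mul, det_mul, mul_right_comm, ← det_mul, hSS, det_nonsing_inv,
      Ring.inverse_eq_inv']
    field_simp
  rw [hd, Real.log_div h₁.det_pos.ne' h₂.det_pos.ne', hk]
  ring

/-- total variation bound between Gaussian measures
(Lemma 4 of the paper).  Since the positive semidefinite square root is
unique, `Ω₂^{−1/2}` is encoded by quantifying over all positive semidefinite
`S₂` with `S₂ * S₂ = Ω₂⁻¹`; note `‖Ω₁^{1/2}(μ₁−μ₂)‖₂² = (μ₁−μ₂)ᵀΩ₁(μ₁−μ₂)`. -/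
theorem stmt10 {p : ℕ} (μ₁ μ₂ : Vec p) (Ω₁ Ω₂ : Mat p)
    (h₁ : Ω₁.PosDef) (h₂ : Ω₂.PosDef) :
    ∀ S₂ : Mat p, S₂.PosSemidef → S₂ * S₂ = Ω₂⁻¹ →
      specNorm (S₂ * Ω₁ * S₂ - 1) ≤ 0.684 →
      tvDist (gaussianOfPrec μ₁ Ω₁) (gaussianOfPrec μ₂ Ω₂)
        ≤ (1 / 2) *
            Real.sqrt (quadForm Ω₁ (μ₁ - μ₂) + frobNorm (S₂ * Ω₁ * S₂ - 1) ^ 2) := by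
  intro S hS hSS hsp
  have hC : (S * Ω₁ * S - 1).IsHermitian := by
    refine IsHermitian.sub ?_ isHermitian_one
    have := isHermitian_mul_mul_conjTranspose S h₁.isHermitian
    rwa [hS.isHermitian.eq] at this
  have hm := aux_mat _ hC hsp
  have hq : 0 ≤ quadForm Ω₁ (μ₁ - μ₂) := by
    obtain ⟨R, hR, hRR⟩ := exists_root Ω₁⁻¹ h₁.inv
    rw [nonsing_inv_nonsing_inv _ (by simpa using h₁.det_pos.ne')] at hRR
    rw [← hRR, quadForm, mApp_mul, ← inner_mApp_symm _ hR.isHermitian]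
    exact real_inner_self_nonneg
  have hF : 0 ≤ frobNorm (S * Ω₁ * S - 1) ^ 2 := sq_nonneg _
  unfold tvDist
  have : Nonempty {s : Set (Vec p) // MeasurableSet s} := ⟨⟨∅, MeasurableSet.empty⟩⟩
  refine ciSup_le fun s => ?_
  have ht := gauss_tv_set μ₁ μ₂ Ω₁ Ω₂ h₁ h₂ S hS hSS s.1 s.2
  simp only [Measure.real] at ht
  rw [abs_sub_comm]
  generalize ((gaussianOfPrec μ₂ Ω₂) s.1).toReal - ((gaussianOfPrec μ₁ Ω₁) s.1).toReal = t at *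
  generalize quadForm Ω₁ (μ₁ - μ₂) = q at *
  generalize frobNorm (S * Ω₁ * S - 1) ^ 2 = F at *
  have key : t ^ 2 ≤ (q + F) / 4 := by
    by_contra hcon
    push Not at hcon
    have hb : 0 ≤ (q + F) / 4 := by positivity
    have h4 : ((q + F) / 4) ^ 2 ≤ (t ^ 2) ^ 2 := by gcongr
    nlinarith [mul_nonneg hq hF, sq_nonneg q]
  have e : (1 / 2 : ℝ) * Real.sqrt (q + F) = Real.sqrt ((q + F) / 4) := by
    rw [Real.sqrt_div (by positivity), show (4 : ℝ) = 2 ^ 2 by norm_num,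
      Real.sqrt_sq (by norm_num)]
    ring
  rw [e]
  exact Real.abs_le_sqrt key
end
end
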